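/- There exist complex 4×4 matrices γ, η₀, η₁, η₂ with η₂ = η₀* (conjugate transpose) and η₁ = η₁*, such that for all i, j, k ∈ {0, 1, 2}: Tr(γ ηᵢ ηⱼ η_k) = c(i, j, k), where c(0,1,2) = 1, c(1,0,2) = c(0,2,1) = −q⁴, c(2,1,0) = −q^{10}, c(1,2,0) = c(2,0,1) = q⁶, and c(i, j, k) = 0 for all other triples (i, j, k). -/

import Mathlib

noncomputable section

/-- The prescribed values `c(i,j,k) = π(ωᵢ ωⱼ ω_k)` for the 3D-calculus on `SU_q(2)`:
`c(0,1,2) = 1`, `c(1,0,2) = c(0,2,1) = -q⁴`, `c(2,1,0) = -q¹⁰`,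
`c(1,2,0) = c(2,0,1) = q⁶`, and `c(i,j,k) = 0` otherwise. -/
def piOmega (q : ℝ) (i j k : Fin 3) : ℂ :=
  if (i, j, k) = (0, 1, 2) then 1
  else if (i, j, k) = (1, 0, 2) ∨ (i, j, k) = (0, 2, 1) then -(q : ℂ) ^ 4
  else if (i, j, k) = (2, 1, 0) then -(q : ℂ) ^ 10
  else if (i, j, k) = (1, 2, 0) ∨ (i, j, k) = (2, 0, 1) then (q : ℂ) ^ 6
  else 0

/-- there exist complex 4×4 matrices `γ, η₀, η₁, η₂` with `η₂ = η₀*`,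
`η₁ = η₁*`, such that `Tr(γ ηᵢ ηⱼ η_k) = c(i,j,k)` for all `i, j, k ∈ {0,1,2}`. -/
theorem stmt_12 (q : ℝ) (hq0 : 0 < q) (hq1 : q < 1) :
    ∃ (γ : Matrix (Fin 4) (Fin 4) ℂ) (η : Fin 3 → Matrix (Fin 4) (Fin 4) ℂ),
      η 2 = (η 0).conjTranspose ∧ η 1 = (η 1).conjTranspose ∧
      ∀ i j k : Fin 3, (γ * η i * η j * η k).trace = piOmega q i j k := by
  refine ⟨!![(q:ℂ)^6,0,0,0; 0,-(q:ℂ)^9,0,0; 0,0,1,0; 0,0,0,-(q:ℂ)^3],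
    ![!![0,0,0,0; 0,0,0,0; 1,0,0,0; 0,1,0,0],
      !![1,0,0,0; 0,0,0,0; 0,0,0,0; 0,0,0,(q:ℂ)],
      !![0,0,1,0; 0,0,0,1; 0,0,0,0; 0,0,0,0]], ?_, ?_, ?_⟩
  · ext i j
    fin_cases i <;> fin_cases j <;> simp [Matrix.conjTranspose_apply]
  · ext i j
    fin_cases i <;> fin_cases j <;> simp [Matrix.conjTranspose_apply]
  · intro i j k
    fin_cases i <;> fin_cases j <;> fin_cases k <;>
      simp [piOmega, Matrix.trace, Fin.sum_univ_four, Matrix.mul_apply] <;> ring
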